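/- arXiv:2212.08426 — 8 statements merged into one kernel-verified Lean document; each statement's English description precedes it below -/
import Mathlib

section
/- Let R be a real symmetric positive semidefinite m×m matrix, S a real m×n matrix, g ∈ ℝ^m, and R⁺ a Moore–Penrose pseudoinverse of R. Assume the kernel containment: every v ∈ ℝ^m with R v = 0 satisfies Sᵀ v = 0 and gᵀ v = 0. Then the (m+n+1)×(m+n+1) symmetric block matrix H = [[R, S, g], [Sᵀ, SᵀR⁺S, SᵀR⁺g], [gᵀ, gᵀR⁺S, gᵀR⁺g]] is positive semidefinite and rank(H) = rank(R). -/
open Matrix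

/-- `Rp` is a Moore–Penrose pseudoinverse of `R`. -/
def IsMoorePenrose {m : ℕ} (R Rp : Matrix (Fin m) (Fin m) ℝ) : Prop :=
  R * Rp * R = R ∧ Rp * R * Rp = Rp ∧ (R * Rp)ᵀ = R * Rp ∧ (Rp * R)ᵀ = Rp * R

/-- The `(m+n+1)×(m+n+1)` symmetric block matrix
`[[R, S, g], [Sᵀ, C, β], [gᵀ, βᵀ, ξ]]`. -/
def blockH {m n : ℕ} (R : Matrix (Fin m) (Fin m) ℝ) (S : Matrix (Fin m) (Fin n) ℝ)
    (g : Fin m → ℝ) (C : Matrix (Fin n) (Fin n) ℝ) (β : Fin n → ℝ) (ξ : ℝ) :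
    Matrix (Fin m ⊕ (Fin n ⊕ Unit)) (Fin m ⊕ (Fin n ⊕ Unit)) ℝ :=
  Matrix.of fun i j =>
    match i, j with
    | .inl i, .inl j => R i j
    | .inl i, .inr (.inl j) => S i j
    | .inl i, .inr (.inr _) => g i
    | .inr (.inl i), .inl j => S j i
    | .inr (.inl i), .inr (.inl j) => C i j
    | .inr (.inl i), .inr (.inr _) => β i
    | .inr (.inr _), .inl j => g j
    | .inr (.inr _), .inr (.inl j) => β j
    | .inr (.inr _), .inr (.inr _) => ξ

theorem psd_and_rank_of_kernel_containment {m n : ℕ}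
    (R Rp : Matrix (Fin m) (Fin m) ℝ) (S : Matrix (Fin m) (Fin n) ℝ) (g : Fin m → ℝ)
    (hR : R.PosSemidef) (hRp : IsMoorePenrose R Rp)
    (hker : ∀ v : Fin m → ℝ, R.mulVec v = 0 → Sᵀ.mulVec v = 0 ∧ g ⬝ᵥ v = 0) :
    (blockH R S g (Sᵀ * Rp * S) ((Sᵀ * Rp).mulVec g) (g ⬝ᵥ Rp.mulVec g)).PosSemidef ∧
      (blockH R S g (Sᵀ * Rp * S) ((Sᵀ * Rp).mulVec g) (g ⬝ᵥ Rp.mulVec g)).rank = R.rank := by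
  obtain ⟨h1, h2, h3, h4⟩ := hRp
  have hRt : Rᵀ = R := by simpa [conjTranspose_eq_transpose_of_trivial] using hR.isHermitian.eq
  have hRR : R * (R * Rp) = R := by
    have h := congrArg transpose h1
    rw [transpose_mul, h3, hRt] at h
    exact h
  have hz : ∀ x : Fin m → ℝ, R.mulVec (x - (R * Rp).mulVec x) = 0 := by
    intro x
    rw [mulVec_sub, mulVec_mulVec, hRR, sub_self]
  have hS' : Sᵀ * (R * Rp) = Sᵀ := by
    apply Matrix.ext_of_mulVec_single
    intro i
    have h := (hker _ (hz (Pi.single i 1))).1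
    rw [mulVec_sub, mulVec_mulVec, sub_eq_zero] at h
    exact h.symm
  have hS : R * Rp * S = S := by
    have h := congrArg transpose hS'
    rwa [transpose_mul, h3, transpose_transpose] at h
  have hg : (R * Rp).mulVec g = g := by
    have h : ∀ x, (R * Rp).mulVec g ⬝ᵥ x = g ⬝ᵥ x := by
      intro x
      have h := (hker _ (hz x)).2
      rw [dotProduct_sub, sub_eq_zero, dotProduct_mulVec, ← mulVec_transpose, h3] at h
      exact h.symm
    exact dotProduct_eq _ _ h
  obtain ⟨K, hK⟩ : ∃ K : Matrix (Fin m) (Fin n ⊕ Unit) ℝ,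
    K = fromCols S (replicateCol Unit g) := ⟨_, rfl⟩
  have hKK : R * Rp * K = K := by
    rw [hK, mul_fromCols, hS, ← replicateCol_mulVec, hg]
  have hKt : Kᵀ * Rpᵀ * R = Kᵀ := by
    have h := congrArg transpose hKK
    rwa [transpose_mul, transpose_mul, hRt, ← Matrix.mul_assoc] at h
  have hsym : Kᵀ * Rp * K = Kᵀ * Rpᵀ * K := by
    calc Kᵀ * Rp * K = Kᵀ * Rpᵀ * R * Rp * K := by rw [hKt]
      _ = Kᵀ * Rpᵀ * (R * Rp * K) := by simp only [Matrix.mul_assoc]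
      _ = _ := by rw [hKK]
  have hsymt : (Kᵀ * Rp * K)ᵀ = Kᵀ * Rp * K := by
    rw [hsym]
    simp [transpose_mul, Matrix.mul_assoc]
    simpa [Matrix.mul_assoc] using hsym
  have e12 : ∀ j u, (Kᵀ * Rp * K) (.inl j) (.inr u) = ((Sᵀ * Rp).mulVec g) j := by
    intro j u
    simp [hK, Matrix.mul_apply, mulVec, dotProduct]
  have hH : blockH R S g (Sᵀ * Rp * S) ((Sᵀ * Rp).mulVec g) (g ⬝ᵥ Rp.mulVec g)
      = fromBlocks R K Kᵀ (Kᵀ * Rp * K) := by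
    ext i j
    rcases i with i | i | i <;> rcases j with j | j | j
    · rfl
    · simp [blockH, hK]
    · simp [blockH, hK]
    · simp [blockH, hK]
    · simp [blockH, hK, Matrix.mul_apply]
    · exact (e12 i j).symm
    · simp [blockH, hK]
    · rw [fromBlocks_apply₂₂, ← hsymt, transpose_apply, e12]
      rfl
    · rw [fromBlocks_apply₂₂, Matrix.mul_assoc]
      simp [blockH, hK, Matrix.mul_apply, mulVec, dotProduct]
      simp only [Finset.mul_sum, Finset.sum_mul]
      rw [Finset.sum_comm]
      simp only [mul_assoc]
  have hfac : fromBlocks R K Kᵀ (Kᵀ * Rp * K)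
      = (fromCols 1 (Rp * K))ᵀ * R * fromCols 1 (Rp * K) := by
    rw [transpose_fromCols, fromRows_mul, fromRows_mul_fromCols]
    simp only [transpose_one, Matrix.one_mul, Matrix.mul_one, transpose_mul, hKt]
    rw [← Matrix.mul_assoc, hKK, Matrix.mul_assoc]
  rw [hH]
  constructor
  · rw [hfac, ← conjTranspose_eq_transpose_of_trivial]
    exact hR.conjTranspose_mul_mul_same _
  · apply le_antisymm
    · rw [hfac]
      exact (rank_mul_le_left _ _).trans (rank_mul_le_right _ _)
    · exact rank_submatrix_le (fromBlocks R K Kᵀ (Kᵀ * Rp * K)) Sum.inl Sum.inl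
end

section
/- Let H = [[R, S, g], [Sᵀ, C, β], [gᵀ, βᵀ, ξ]] be a real symmetric (m+n+1)×(m+n+1) block matrix, where R is m×m symmetric, C is n×n symmetric, S is m×n, g ∈ ℝ^m, β ∈ ℝ^n, ξ ∈ ℝ, and let R⁺ be a Moore–Penrose pseudoinverse of R. If H is positive semidefinite and rank(H) = rank(R), then: (i) R is positive semidefinite; (ii) every v ∈ ℝ^m with R v = 0 satisfies Sᵀ v = 0 and gᵀ v = 0; (iii) C = SᵀR⁺S, β = SᵀR⁺g, and ξ = gᵀR⁺g. -/
open Matrix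

theorem kernel_containment_and_schur_of_psd_rank {m n : ℕ}
    (R Rp : Matrix (Fin m) (Fin m) ℝ) (S : Matrix (Fin m) (Fin n) ℝ) (g : Fin m → ℝ)
    (C : Matrix (Fin n) (Fin n) ℝ) (β : Fin n → ℝ) (ξ : ℝ)
    (hRsymm : R.IsSymm) (hCsymm : C.IsSymm) (hRp : IsMoorePenrose R Rp)
    (hH : (blockH R S g C β ξ).PosSemidef)
    (hrank : (blockH R S g C β ξ).rank = R.rank) :
    R.PosSemidef ∧
      (∀ v : Fin m → ℝ, R.mulVec v = 0 → Sᵀ.mulVec v = 0 ∧ g ⬝ᵥ v = 0) ∧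
      C = Sᵀ * Rp * S ∧ β = (Sᵀ * Rp).mulVec g ∧ ξ = g ⬝ᵥ Rp.mulVec g := by
  obtain ⟨h1, -, -, -⟩ := hRp
  have hRT : Rᵀ = R := hRsymm
  set H := blockH R S g C β ξ with hHdef
  set K : Matrix (Fin m ⊕ (Fin n ⊕ Unit)) (Fin m) ℝ := H.submatrix id Sum.inl with hK
  have hR : R = H.submatrix Sum.inl Sum.inl := by
    ext i j; rfl
  have hcol : ∀ w : Fin m → ℝ, K *ᵥ w = H *ᵥ (Sum.elim w 0) := by
    intro w
    ext i
    simp [Matrix.mulVec, dotProduct, hK]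
  have hle : LinearMap.range K.mulVecLin ≤ LinearMap.range H.mulVecLin := by
    rintro _ ⟨w, rfl⟩
    exact ⟨Sum.elim w 0, by simp [hcol]⟩
  have hrk : H.rank ≤ K.rank := by
    rw [hrank]
    have : R = K.submatrix Sum.inl id := by ext i j; rfl
    rw [this]
    exact Matrix.rank_submatrix_le _ _ _
  have heq : LinearMap.range K.mulVecLin = LinearMap.range H.mulVecLin :=
    Submodule.eq_of_le_of_finrank_le hle hrk
  have hex : ∀ j, ∃ w : Fin m → ℝ, K *ᵥ w = fun i => H i j := by
    intro j
    have : (fun i => H i j) ∈ LinearMap.range H.mulVecLin :=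
      ⟨Pi.single j 1, by ext i; simp⟩
    rw [← heq] at this
    obtain ⟨w, hw⟩ := this
    exact ⟨w, hw⟩
  choose w hw using hex
  have hS : S = R * Matrix.of fun k j => w (.inr (.inl j)) k := by
    ext i j
    exact (congrFun (hw (.inr (.inl j))) (.inl i)).symm
  have hC : C = Sᵀ * Matrix.of fun k j => w (.inr (.inl j)) k := by
    ext i j
    exact (congrFun (hw (.inr (.inl j))) (.inr (.inl i))).symm
  have hg : g = R *ᵥ w (.inr (.inr ())) := by
    ext i
    exact (congrFun (hw (.inr (.inr ()))) (.inl i)).symm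
  have hβ : β = Sᵀ *ᵥ w (.inr (.inr ())) := by
    ext i
    exact (congrFun (hw (.inr (.inr ()))) (.inr (.inl i))).symm
  have hξ : ξ = g ⬝ᵥ w (.inr (.inr ())) :=
    (congrFun (hw (.inr (.inr ()))) (.inr (.inr ()))).symm
  have hpsd : R.PosSemidef := by rw [hR]; exact hH.submatrix _
  clear_value H K
  generalize (Matrix.of fun k j => w (.inr (.inl j)) k : Matrix (Fin m) (Fin n) ℝ) = W at hS hC
  generalize w (.inr (.inr ())) = u at hg hβ hξ
  have hST : Sᵀ = Wᵀ * R := by rw [hS, Matrix.transpose_mul, hRT]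
  have hgd : ∀ v, g ⬝ᵥ v = u ⬝ᵥ (R *ᵥ v) := by
    intro v
    rw [hg, Matrix.dotProduct_mulVec, ← Matrix.mulVec_transpose, hRT]
  refine ⟨hpsd, fun v hv => ⟨?_, ?_⟩, ?_, ?_, ?_⟩
  · rw [hST, ← Matrix.mulVec_mulVec, hv, Matrix.mulVec_zero]
  · rw [hgd, hv, dotProduct_zero]
  · calc C = Wᵀ * (R * Rp * R) * W := by rw [hC, hST, h1]
      _ = Sᵀ * Rp * S := by rw [hST, hS]; simp only [Matrix.mul_assoc]
  · calc β = (Wᵀ * (R * Rp * R)) *ᵥ u := by rw [hβ, hST, h1]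
      _ = (Sᵀ * Rp) *ᵥ g := by rw [hST, hg, Matrix.mulVec_mulVec]; simp only [Matrix.mul_assoc]
  · calc ξ = u ⬝ᵥ ((R * Rp * R) *ᵥ u) := by rw [hξ, hgd, h1]
      _ = g ⬝ᵥ Rp *ᵥ g := by
        rw [hgd, hg]; simp only [Matrix.mulVec_mulVec, Matrix.mul_assoc]
end

section
/- Let A be a real n×n matrix, B a real n×m matrix, P₊ and Q real symmetric n×n matrices, R a real symmetric m×m matrix, and η₊, q, d ∈ ℝ^n. Define 𝔯 := BᵀP₊B + R, 𝔰 := BᵀP₊A, g := Bᵀη₊ + BᵀP₊d, and let 𝔯⁺ be a Moore–Penrose pseudoinverse of 𝔯. Assume 𝔯 is positive semidefinite and that every v with 𝔯 v = 0 satisfies 𝔰ᵀ v = 0 and gᵀ v = 0. Define P := AᵀP₊A + Q − 𝔰ᵀ𝔯⁺𝔰 and η := (A − B𝔯⁺𝔰)ᵀ(η₊ + P₊ d) + q. Then for every χ ∈ ℝ^n, the infimum over u ∈ ℝ^m of (1/2)χᵀQχ + qᵀχ + (1/2)uᵀRu + (1/2)(Aχ + Bu + d)ᵀP₊(Aχ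 + Bu + d) + η₊ᵀ(Aχ + Bu + d) equals (1/2)χᵀPχ + ηᵀχ − (1/2)gᵀ𝔯⁺g + (1/2)dᵀP₊d + η₊ᵀd, and the infimum is attained at u = −𝔯⁺(𝔰χ + g). -/
open Matrix

theorem dot_transpose_aux {k l : ℕ} (M : Matrix (Fin k) (Fin l) ℝ) (x : Fin l → ℝ) (y : Fin k → ℝ) :
    x ⬝ᵥ Mᵀ *ᵥ y = (M *ᵥ x) ⬝ᵥ y := by
  rw [Matrix.dotProduct_mulVec, Matrix.vecMul_transpose]

theorem dot_symm_aux {k : ℕ} (M : Matrix (Fin k) (Fin k) ℝ) (h : M.IsSymm) (x y : Fin k → ℝ) :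
    x ⬝ᵥ M *ᵥ y = y ⬝ᵥ M *ᵥ x := by
  conv_lhs => rw [← h.eq, dot_transpose_aux, dotProduct_comm]

theorem one_step_dynamic_programming {n m : ℕ}
    (A : Matrix (Fin n) (Fin n) ℝ) (B : Matrix (Fin n) (Fin m) ℝ)
    (Pp Q : Matrix (Fin n) (Fin n) ℝ) (R : Matrix (Fin m) (Fin m) ℝ)
    (ηp q d : Fin n → ℝ)
    (hPp : Pp.IsSymm) (hQ : Q.IsSymm) (hR : R.IsSymm)
    -- the one-step Riccati-related quantities
    (𝔯 : Matrix (Fin m) (Fin m) ℝ) (h𝔯 : 𝔯 = Bᵀ * Pp * B + R)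
    (𝔰 : Matrix (Fin m) (Fin n) ℝ) (h𝔰 : 𝔰 = Bᵀ * Pp * A)
    (g : Fin m → ℝ) (hg : g = Bᵀ.mulVec ηp + (Bᵀ * Pp).mulVec d)
    (𝔯p : Matrix (Fin m) (Fin m) ℝ) (h𝔯p : IsMoorePenrose 𝔯 𝔯p)
    (h𝔯psd : 𝔯.PosSemidef)
    (hker : ∀ v : Fin m → ℝ, 𝔯.mulVec v = 0 → 𝔰ᵀ.mulVec v = 0 ∧ g ⬝ᵥ v = 0)
    (P : Matrix (Fin n) (Fin n) ℝ) (hP : P = Aᵀ * Pp * A + Q - 𝔰ᵀ * 𝔯p * 𝔰)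
    (η : Fin n → ℝ) (hη : η = (A - B * 𝔯p * 𝔰)ᵀ.mulVec (ηp + Pp.mulVec d) + q) :
    ∀ χ : Fin n → ℝ,
      IsLeast
        (Set.range fun u : Fin m → ℝ =>
          (1 / 2 : ℝ) * (χ ⬝ᵥ Q.mulVec χ) + q ⬝ᵥ χ + (1 / 2 : ℝ) * (u ⬝ᵥ R.mulVec u)
            + (1 / 2 : ℝ) * ((A.mulVec χ + B.mulVec u + d) ⬝ᵥ
                Pp.mulVec (A.mulVec χ + B.mulVec u + d))
            + ηp ⬝ᵥ (A.mulVec χ + B.mulVec u + d))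
        ((1 / 2 : ℝ) * (χ ⬝ᵥ P.mulVec χ) + η ⬝ᵥ χ - (1 / 2 : ℝ) * (g ⬝ᵥ 𝔯p.mulVec g)
          + (1 / 2 : ℝ) * (d ⬝ᵥ Pp.mulVec d) + ηp ⬝ᵥ d) ∧
      ((fun u : Fin m → ℝ =>
          (1 / 2 : ℝ) * (χ ⬝ᵥ Q.mulVec χ) + q ⬝ᵥ χ + (1 / 2 : ℝ) * (u ⬝ᵥ R.mulVec u)
            + (1 / 2 : ℝ) * ((A.mulVec χ + B.mulVec u + d) ⬝ᵥ
                Pp.mulVec (A.mulVec χ + B.mulVec u + d))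
            + ηp ⬝ᵥ (A.mulVec χ + B.mulVec u + d))
        (-(𝔯p.mulVec (𝔰.mulVec χ + g))) =
        (1 / 2 : ℝ) * (χ ⬝ᵥ P.mulVec χ) + η ⬝ᵥ χ - (1 / 2 : ℝ) * (g ⬝ᵥ 𝔯p.mulVec g)
          + (1 / 2 : ℝ) * (d ⬝ᵥ Pp.mulVec d) + ηp ⬝ᵥ d) := by
  intro χ
  have hrs : 𝔯.IsSymm := by
    have := h𝔯psd.isHermitian
    rwa [Matrix.IsHermitian, Matrix.conjTranspose_eq_transpose_of_trivial] at this
  have hpen := h𝔯p.1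
  have hk : ∀ x : Fin m → ℝ, 𝔯 *ᵥ (x - 𝔯pᵀ *ᵥ (𝔯 *ᵥ x)) = 0 := by
    intro x
    have h2 : 𝔯 * 𝔯pᵀ * 𝔯 = 𝔯 := by
      have := congrArg Matrix.transpose hpen
      simpa [Matrix.transpose_mul, hrs.eq, Matrix.mul_assoc] using this
    rw [Matrix.mulVec_sub, Matrix.mulVec_mulVec, Matrix.mulVec_mulVec, h2, sub_self]
  have hfix : ∀ w : Fin m → ℝ, (∀ v, 𝔯 *ᵥ v = 0 → v ⬝ᵥ w = 0) → 𝔯 *ᵥ (𝔯p *ᵥ w) = w := by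
    intro w hw
    refine dotProduct_eq _ _ fun x => ?_
    have h := hw _ (hk x)
    rw [sub_dotProduct, dotProduct_comm (𝔯pᵀ *ᵥ (𝔯 *ᵥ x)) w, dot_transpose_aux,
      dot_symm_aux 𝔯 hrs, dotProduct_comm x w, dotProduct_comm x] at h
    linarith
  have hs : 𝔯 *ᵥ (𝔯p *ᵥ (𝔰 *ᵥ χ)) = 𝔰 *ᵥ χ := by
    apply hfix
    intro v hv
    rw [dotProduct_comm, ← dot_transpose_aux, (hker v hv).1, dotProduct_zero]
  have hgf : 𝔯 *ᵥ (𝔯p *ᵥ g) = g := by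
    apply hfix
    intro v hv
    rw [dotProduct_comm, (hker v hv).2]
  -- symmetry of the mixed term
  have hmix : (𝔰 *ᵥ χ) ⬝ᵥ 𝔯p *ᵥ g = g ⬝ᵥ 𝔯p *ᵥ (𝔰 *ᵥ χ) := by
    have h1 := dot_symm_aux 𝔯 hrs (𝔯p *ᵥ g) (𝔯p *ᵥ (𝔰 *ᵥ χ))
    rw [hs, hgf] at h1
    rw [dotProduct_comm, h1, dotProduct_comm]
  have hgdot : ∀ u, u ⬝ᵥ g = (B *ᵥ u) ⬝ᵥ ηp + (B *ᵥ u) ⬝ᵥ Pp *ᵥ d := by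
    intro u
    rw [hg, dotProduct_add, ← Matrix.mulVec_mulVec, dot_transpose_aux, dot_transpose_aux]
  have hsdot : ∀ u, u ⬝ᵥ 𝔰 *ᵥ χ = (B *ᵥ u) ⬝ᵥ Pp *ᵥ (A *ᵥ χ) := by
    intro u
    rw [h𝔰, ← Matrix.mulVec_mulVec, ← Matrix.mulVec_mulVec, dot_transpose_aux]
  have hrdot : ∀ u, u ⬝ᵥ 𝔯 *ᵥ u = (B *ᵥ u) ⬝ᵥ Pp *ᵥ (B *ᵥ u) + u ⬝ᵥ R *ᵥ u := by
    intro u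
    rw [h𝔯, Matrix.add_mulVec, dotProduct_add, ← Matrix.mulVec_mulVec, ← Matrix.mulVec_mulVec,
      dot_transpose_aux]
  have hPdot : χ ⬝ᵥ P *ᵥ χ = (A *ᵥ χ) ⬝ᵥ Pp *ᵥ (A *ᵥ χ) + χ ⬝ᵥ Q *ᵥ χ
      - (𝔰 *ᵥ χ) ⬝ᵥ 𝔯p *ᵥ (𝔰 *ᵥ χ) := by
    rw [hP, Matrix.sub_mulVec, Matrix.add_mulVec, dotProduct_sub, dotProduct_add,
      ← Matrix.mulVec_mulVec, ← Matrix.mulVec_mulVec, ← Matrix.mulVec_mulVec,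
      ← Matrix.mulVec_mulVec, dot_transpose_aux, dot_transpose_aux]
  have hηdot : η ⬝ᵥ χ = (A *ᵥ χ) ⬝ᵥ ηp + (A *ᵥ χ) ⬝ᵥ Pp *ᵥ d
      - g ⬝ᵥ 𝔯p *ᵥ (𝔰 *ᵥ χ) + q ⬝ᵥ χ := by
    rw [dotProduct_comm g, hgdot, hη, add_dotProduct, dotProduct_comm _ χ, dot_transpose_aux,
      Matrix.sub_mulVec, ← Matrix.mulVec_mulVec, ← Matrix.mulVec_mulVec, sub_dotProduct,
      dotProduct_add, dotProduct_add]
  have key : ∀ u : Fin m → ℝ,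
      (1 / 2 : ℝ) * (χ ⬝ᵥ Q.mulVec χ) + q ⬝ᵥ χ + (1 / 2 : ℝ) * (u ⬝ᵥ R.mulVec u)
            + (1 / 2 : ℝ) * ((A.mulVec χ + B.mulVec u + d) ⬝ᵥ
                Pp.mulVec (A.mulVec χ + B.mulVec u + d))
            + ηp ⬝ᵥ (A.mulVec χ + B.mulVec u + d)
      = ((1 / 2 : ℝ) * (χ ⬝ᵥ P.mulVec χ) + η ⬝ᵥ χ - (1 / 2 : ℝ) * (g ⬝ᵥ 𝔯p.mulVec g)
          + (1 / 2 : ℝ) * (d ⬝ᵥ Pp.mulVec d) + ηp ⬝ᵥ d)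
        + (1 / 2 : ℝ) * ((u + 𝔯p *ᵥ (𝔰 *ᵥ χ + g)) ⬝ᵥ 𝔯 *ᵥ (u + 𝔯p *ᵥ (𝔰 *ᵥ χ + g))) := by
    intro u
    have e1 : (u + 𝔯p *ᵥ (𝔰 *ᵥ χ + g)) ⬝ᵥ 𝔯 *ᵥ (u + 𝔯p *ᵥ (𝔰 *ᵥ χ + g))
        = u ⬝ᵥ 𝔯 *ᵥ u + 2 * (u ⬝ᵥ 𝔰 *ᵥ χ) + 2 * (u ⬝ᵥ g)
          + (𝔰 *ᵥ χ) ⬝ᵥ 𝔯p *ᵥ (𝔰 *ᵥ χ) + 2 * (g ⬝ᵥ 𝔯p *ᵥ (𝔰 *ᵥ χ)) + g ⬝ᵥ 𝔯p *ᵥ g := by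
      have f : 𝔯 *ᵥ (𝔯p *ᵥ (𝔰 *ᵥ χ + g)) = 𝔰 *ᵥ χ + g := by
        rw [Matrix.mulVec_add, Matrix.mulVec_add, hs, hgf]
      rw [Matrix.mulVec_add 𝔯 u, add_dotProduct, dotProduct_add, dotProduct_add,
        dot_symm_aux 𝔯 hrs (𝔯p *ᵥ (𝔰 *ᵥ χ + g)) u, f,
        dotProduct_comm (𝔯p *ᵥ (𝔰 *ᵥ χ + g)), Matrix.mulVec_add]
      simp only [dotProduct_add, add_dotProduct]
      rw [hmix]
      ring
    rw [e1, hPdot, hηdot, hrdot, hsdot, hgdot]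
    simp only [Matrix.mulVec_add, dotProduct_add, add_dotProduct]
    rw [dot_symm_aux Pp hPp (A *ᵥ χ) (B *ᵥ u), dot_symm_aux Pp hPp d (B *ᵥ u),
      dot_symm_aux Pp hPp d (A *ᵥ χ), dotProduct_comm ηp (A *ᵥ χ), dotProduct_comm ηp (B *ᵥ u)]
    ring
  have hopt := key (-(𝔯p.mulVec (𝔰.mulVec χ + g)))
  rw [neg_add_cancel, zero_dotProduct, mul_zero, add_zero] at hopt
  refine ⟨⟨⟨_, hopt⟩, ?_⟩, hopt⟩
  rintro _ ⟨u, rfl⟩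
  have hnn := h𝔯psd.dotProduct_mulVec_nonneg (u + 𝔯p *ᵥ (𝔰 *ᵥ χ + g))
  rw [star_trivial] at hnn
  have hu := key u
  dsimp only
  rw [hu]
  linarith
end

section
/- Let R be a real symmetric positive definite m×m matrix, A an invertible real n×n matrix, B a real n×m matrix, and P a real symmetric n×n matrix. Define 𝔯 := BᵀPB + R and 𝔰 := BᵀPA. If 𝔯 is positive semidefinite and every v with 𝔯 v = 0 satisfies 𝔰ᵀ v = 0, then 𝔯 is positive definite. -/
open Matrix

theorem posDef_of_kernel_containment {n m : ℕ}
    (R : Matrix (Fin m) (Fin m) ℝ) (A : Matrix (Fin n) (Fin n) ℝ)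
    (B : Matrix (Fin n) (Fin m) ℝ) (P : Matrix (Fin n) (Fin n) ℝ)
    (hR : R.PosDef) (hA : IsUnit A) (hP : P.IsSymm)
    (hpsd : (Bᵀ * P * B + R).PosSemidef)
    (hker : ∀ v : Fin m → ℝ, (Bᵀ * P * B + R).mulVec v = 0 → (Bᵀ * P * A)ᵀ.mulVec v = 0) :
    (Bᵀ * P * B + R).PosDef := by
  refine .of_dotProduct_mulVec_pos hpsd.1 fun v hv => ?_
  refine lt_of_le_of_ne (hpsd.dotProduct_mulVec_nonneg v) fun h0 => ?_
  have hk := (hpsd.dotProduct_mulVec_zero_iff v).1 h0.symm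
  have hs := hker v hk
  have hAt : IsUnit Aᵀ := (Matrix.isUnit_transpose A).2 hA
  have hPB : (P * B) *ᵥ v = 0 := by
    apply Matrix.mulVec_injective_of_isUnit hAt
    rw [Matrix.mulVec_zero, Matrix.mulVec_mulVec, ← hs]
    simp only [Matrix.transpose_mul, Matrix.transpose_transpose, hP.eq]
  have hRv : R *ᵥ v = 0 := by
    rw [Matrix.add_mulVec, Matrix.mul_assoc, ← Matrix.mulVec_mulVec, hPB,
      Matrix.mulVec_zero, zero_add] at hk
    exact hk
  have hpos := hR.dotProduct_mulVec_pos hv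
  rw [hRv, dotProduct_zero] at hpos
  exact lt_irrefl _ hpos
end

section
/- Let R be a real symmetric positive definite m×m matrix, A an invertible real n×n matrix, B a real n×m matrix, and P a real symmetric n×n matrix such that 𝔯 := BᵀPB + R is positive definite. Then A_cl := A − B 𝔯⁻¹ BᵀP A is invertible. Moreover, for any v ∈ ℝ^n, the (n+1)×(n+1) block matrix [[A_cl, v], [0ᵀ, 1]] is invertible. -/
open Matrix

theorem closed_loop_matrix_invertible {n m : ℕ}
    (R : Matrix (Fin m) (Fin m) ℝ) (A : Matrix (Fin n) (Fin n) ℝ)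
    (B : Matrix (Fin n) (Fin m) ℝ) (P : Matrix (Fin n) (Fin n) ℝ)
    (hR : R.PosDef) (hA : IsUnit A) (hP : P.IsSymm)
    (h𝔯 : (Bᵀ * P * B + R).PosDef) :
    IsUnit (A - B * (Bᵀ * P * B + R)⁻¹ * (Bᵀ * P * A)) ∧
      ∀ v : Fin n → ℝ,
        IsUnit (Matrix.of (fun i j : Fin n ⊕ Unit =>
          match i, j with
          | .inl i, .inl j => (A - B * (Bᵀ * P * B + R)⁻¹ * (Bᵀ * P * A)) i j
          | .inl i, .inr _ => v i
          | .inr _, .inl _ => (0 : ℝ)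
          | .inr _, .inr _ => (1 : ℝ))) := by
  have hr : IsUnit (Bᵀ * P * B + R) := h𝔯.isUnit
  have hrd := (Matrix.isUnit_iff_isUnit_det _).1 hr
  have key : IsUnit (A - B * (Bᵀ * P * B + R)⁻¹ * (Bᵀ * P * A)) := by
    have h1 : A - B * (Bᵀ * P * B + R)⁻¹ * (Bᵀ * P * A)
        = (1 - (B * (Bᵀ * P * B + R)⁻¹) * (Bᵀ * P)) * A := by
      simp only [Matrix.sub_mul, Matrix.one_mul, Matrix.mul_assoc]
    have h2 : 1 - (Bᵀ * P) * (B * (Bᵀ * P * B + R)⁻¹) = R * (Bᵀ * P * B + R)⁻¹ := by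
      rw [← Matrix.mul_nonsing_inv _ hrd, ← Matrix.mul_assoc (Bᵀ * P) B, ← Matrix.sub_mul,
        add_sub_cancel_left]
    rw [h1]
    refine IsUnit.mul ?_ hA
    rw [Matrix.isUnit_iff_isUnit_det, Matrix.det_one_sub_mul_comm, h2,
      ← Matrix.isUnit_iff_isUnit_det]
    exact hR.isUnit.mul ((Matrix.isUnit_nonsing_inv_iff).2 hr)
  refine ⟨key, fun v => ?_⟩
  generalize A - B * (Bᵀ * P * B + R)⁻¹ * (Bᵀ * P * A) = M at key ⊢
  have h3 : (Matrix.of (fun i j : Fin n ⊕ Unit =>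
          match i, j with
          | .inl i, .inl j => M i j
          | .inl i, .inr _ => v i
          | .inr _, .inl _ => (0 : ℝ)
          | .inr _, .inr _ => (1 : ℝ)))
      = Matrix.fromBlocks M (Matrix.of fun i (_ : Unit) => v i) 0 1 := by
    ext i j
    rcases i with i | i <;> rcases j with j | j <;> simp
  rw [Matrix.isUnit_iff_isUnit_det] at key ⊢
  rw [h3, Matrix.det_fromBlocks_zero₂₁, Matrix.det_one, mul_one]
  exact key
end

section
/- Let A be a real n×n matrix and B a real n×m matrix such that the controllability matrix [B, AB, A²B, …, A^{n−1}B] has rank n. Let ν be an integer with ν ≥ n+1, and let q ∈ ℝ^n. Define vectors η_ν, η_{ν−1}, …, η_1 ∈ ℝ^n by η_ν = q and η_t = Aᵀ η_{t+1} + q for t = ν−1, …, 1. If Bᵀ η_t = 0 for all t = 1, …, ν, then q = 0. -/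
open Matrix

/-- The controllability matrix `[B, AB, A²B, …, A^{n−1}B]` of the pair `(A, B)`. -/
def ctrbMatrix {n m : ℕ} (A : Matrix (Fin n) (Fin n) ℝ) (B : Matrix (Fin n) (Fin m) ℝ) :
    Matrix (Fin n) (Fin n × Fin m) ℝ :=
  Matrix.of fun i kj => (A ^ (kj.1 : ℕ) * B) i kj.2

theorem linear_cost_identifiability {n m : ℕ}
    (A : Matrix (Fin n) (Fin n) ℝ) (B : Matrix (Fin n) (Fin m) ℝ)
    (hctrb : (ctrbMatrix A B).rank = n)
    (ν : ℕ) (hν : n + 1 ≤ ν) (q : Fin n → ℝ)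
    (η : ℕ → Fin n → ℝ)
    (hην : η ν = q)
    (hrec : ∀ t : ℕ, 1 ≤ t → t < ν → η t = Aᵀ.mulVec (η (t + 1)) + q)
    (hB : ∀ t : ℕ, 1 ≤ t → t ≤ ν → Bᵀ.mulVec (η t) = 0) :
    q = 0 := by
  have key : ∀ k : ℕ, k + 1 < ν →
      η (ν - (k + 1)) = η (ν - k) + (Aᵀ ^ (k + 1)).mulVec q := by
    intro k
    induction k with
    | zero =>
      intro h
      have h1 := hrec (ν - 1) (by omega) (by omega)
      rw [show ν - 1 + 1 = ν by omega, hην] at h1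
      simp only [zero_add, Nat.sub_zero, pow_one, hην, h1]
      exact add_comm _ _
    | succ k ih =>
      intro h
      have h1 := hrec (ν - (k + 1 + 1)) (by omega) (by omega)
      have h2 := hrec (ν - (k + 1)) (by omega) (by omega)
      rw [show ν - (k + 1 + 1) + 1 = ν - (k + 1) by omega, ih (by omega)] at h1
      rw [show ν - (k + 1) + 1 = ν - k by omega] at h2
      rw [h1, h2, Matrix.mulVec_add, Matrix.mulVec_mulVec, ← pow_succ']
      abel
  have hk : ∀ k : ℕ, k < n → Bᵀ.mulVec ((Aᵀ ^ k).mulVec q) = 0 := by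
    intro k hkn
    cases k with
    | zero =>
      have := hB ν (by omega) le_rfl
      rw [hην] at this
      simpa using this
    | succ k =>
      have h1 := hB (ν - (k + 1)) (by omega) (by omega)
      have h2 := hB (ν - k) (by omega) (by omega)
      rw [key k (by omega), Matrix.mulVec_add, h2, zero_add] at h1
      exact h1
  have hli : LinearIndependent ℝ (ctrbMatrix A B).row := by
    rw [linearIndependent_iff_card_eq_finrank_span, Set.finrank,
      ← Matrix.rank_eq_finrank_span_row, hctrb, Fintype.card_fin]
  have hinj := Matrix.vecMul_injective_iff.mpr hli
  apply hinj
  simp only [Matrix.zero_vecMul]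
  funext kj
  obtain ⟨k, j⟩ := kj
  have h := congrFun (hk k k.2) j
  rw [Matrix.mulVec_mulVec, ← Matrix.transpose_pow, ← Matrix.transpose_mul,
    Matrix.mulVec_transpose] at h
  exact h
end

section
/- Let A be an invertible real n×n matrix, B a real n×m matrix with full column rank such that the controllability matrix [B, AB, …, A^{n−1}B] has rank n, let ν ≥ n+1 be an integer, and let d ∈ ℝ^n. For a real symmetric n×n matrix Q and q ∈ ℝ^n, define backward sequences by P_ν = Q, η_ν = q, and for t = ν−1, …, 1: 𝔯_t = BᵀP_{t+1}B + I, 𝔰_t = BᵀP_{t+1}A, g_t = Bᵀη_{t+1} + BᵀP_{t+1}d, P_t = AᵀP_{t+1}A + Q − 𝔰_tᵀ𝔯_t⁻¹𝔰_t, η_t = (A − B𝔯_t⁻¹𝔰_t)ᵀ(η_{t+1} + P_{t+1}d) + q, and the extended closed-loop matrix Ã_cl(t;Q,q) = [[A − B𝔯_t⁻¹𝔰_t, d − B𝔯_t⁻¹g_t], [0ᵀ, 1]]. Suppose (Q, q) and (Q′, q′) are two such parameter pairs for which all the matrices 𝔯_t and 𝔯′_t, t = 1, …, ν−1, are positive definite.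 If Ã_cl(t;Q,q) = Ã_cl(t;Q′,q′) for all t = 1, …, ν−1, then Q = Q′ and q = q′. -/
open Matrix

/-- The extended closed-loop matrix `[[A − B𝔯⁻¹𝔰, d − B𝔯⁻¹g], [0ᵀ, 1]]` built from
`P₊ = P_{t+1}` and `η₊ = η_{t+1}`, where `𝔯 = BᵀP₊B + I`, `𝔰 = BᵀP₊A` and
`g = Bᵀη₊ + BᵀP₊d`. -/
noncomputable def extClosedLoop {n m : ℕ} (A : Matrix (Fin n) (Fin n) ℝ)
    (B : Matrix (Fin n) (Fin m) ℝ) (d : Fin n → ℝ)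
    (Pp : Matrix (Fin n) (Fin n) ℝ) (ηp : Fin n → ℝ) :
    Matrix (Fin n ⊕ Unit) (Fin n ⊕ Unit) ℝ :=
  Matrix.of fun i j =>
    match i, j with
    | .inl i, .inl j => ((A - B * (Bᵀ * Pp * B + 1)⁻¹ * (Bᵀ * Pp * A) : Matrix (Fin n) (Fin n) ℝ)) i j
    | .inl i, .inr _ =>
        (d - (B * (Bᵀ * Pp * B + 1)⁻¹).mulVec (Bᵀ.mulVec ηp + (Bᵀ * Pp).mulVec d)) i
    | .inr _, .inl _ => (0 : ℝ)
    | .inr _, .inr _ => (1 : ℝ)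

lemma idf_inj {a : Type*} [Finite a] {ι : Type*} [Fintype ι] (M : Matrix a ι ℝ)
    (h : M.rank = Fintype.card ι) : Function.Injective M.mulVec := by
  rw [Matrix.mulVec_injective_iff, linearIndependent_iff_card_eq_finrank_span, Set.finrank,
    ← Matrix.rank_eq_finrank_span_cols, h]

lemma idf_cancel {a ι p : Type*} [Finite a] [Fintype ι] (M : Matrix a ι ℝ)
    (h : Function.Injective M.mulVec) (X Y : Matrix ι p ℝ) (hXY : M * X = M * Y) : X = Y := by
  have : ∀ j, Xᵀ j = Yᵀ j := by
    intro j
    apply h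
    ext i
    exact congrFun (congrFun hXY i) j
  ext i j
  exact congrFun (this j) i

lemma idf_rcancel {n : ℕ} {p : Type*} (A : Matrix (Fin n) (Fin n) ℝ) (hA : IsUnit A)
    (X Y : Matrix p (Fin n) ℝ) (h : X * A = Y * A) : X = Y := by
  have hd := (Matrix.isUnit_iff_isUnit_det _).1 hA
  rw [← Matrix.mul_nonsing_inv_cancel_right A X hd, h, Matrix.mul_nonsing_inv_cancel_right A Y hd]

lemma idf_ctrb {n m : ℕ} (A : Matrix (Fin n) (Fin n) ℝ) (B : Matrix (Fin n) (Fin m) ℝ)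
    (hctrb : (ctrbMatrix A B).rank = n) (v : Fin n → ℝ)
    (hv : ∀ k < n, Bᵀ.mulVec ((Aᵀ ^ k).mulVec v) = 0) : v = 0 := by
  have hi : Function.Injective (ctrbMatrix A B)ᵀ.mulVec :=
    idf_inj _ (by rw [Matrix.rank_transpose, hctrb, Fintype.card_fin])
  apply hi
  rw [Matrix.mulVec_zero]
  ext ⟨k, j⟩
  have h := congrFun (hv k k.2) j
  rw [Matrix.mulVec_mulVec, ← Matrix.transpose_pow, ← Matrix.transpose_mul] at h
  exact h

lemma idf_gain {n m : ℕ} (A : Matrix (Fin n) (Fin n) ℝ) (B : Matrix (Fin n) (Fin m) ℝ)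
    (P : Matrix (Fin n) (Fin n) ℝ) (hr : IsUnit (Bᵀ * P * B + 1))
    (K : Matrix (Fin m) (Fin n) ℝ) (hK : K = (Bᵀ * P * B + 1)⁻¹ * (Bᵀ * P * A)) :
    K = Bᵀ * P * (A - B * K) := by
  have h1 : (Bᵀ * P * B + 1) * K = Bᵀ * P * A := by
    rw [hK, Matrix.mul_nonsing_inv_cancel_left _ _ ((Matrix.isUnit_iff_isUnit_det _).1 hr)]
  rw [Matrix.mul_sub, ← h1, Matrix.add_mul, Matrix.one_mul, ← Matrix.mul_assoc]
  abel

lemma idf_unit {n m : ℕ} (A : Matrix (Fin n) (Fin n) ℝ) (hA : IsUnit A)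
    (B : Matrix (Fin n) (Fin m) ℝ) (C : Matrix (Fin m) (Fin n) ℝ)
    (K : Matrix (Fin m) (Fin n) ℝ) (hK : K = C * (A - B * K)) : IsUnit (A - B * K) := by
  rw [← Matrix.mulVec_injective_iff_isUnit]
  have key : ∀ x, (A - B * K).mulVec x = 0 → x = 0 := by
    intro x hx
    have h1 : K.mulVec x = 0 := by
      rw [hK, ← Matrix.mulVec_mulVec, hx, Matrix.mulVec_zero]
    rw [Matrix.sub_mulVec, ← Matrix.mulVec_mulVec, h1, Matrix.mulVec_zero, sub_zero] at hx
    apply Matrix.mulVec_injective_iff_isUnit.2 hA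
    rw [hx, Matrix.mulVec_zero]
  intro x y hxy
  rw [← sub_eq_zero]
  apply key
  rw [Matrix.mulVec_sub, sub_eq_zero]
  exact hxy

lemma idf_step {n m : ℕ} (A : Matrix (Fin n) (Fin n) ℝ) (B : Matrix (Fin n) (Fin m) ℝ)
    (hA : IsUnit A) (hB : Function.Injective B.mulVec)
    (P P' : Matrix (Fin n) (Fin n) ℝ) (hr : IsUnit (Bᵀ * P * B + 1))
    (hr' : IsUnit (Bᵀ * P' * B + 1))
    (h : A - B * (Bᵀ * P * B + 1)⁻¹ * (Bᵀ * P * A) =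
      A - B * (Bᵀ * P' * B + 1)⁻¹ * (Bᵀ * P' * A)) :
    Bᵀ * P = Bᵀ * P' := by
  have h2 := sub_right_injective h
  simp only [Matrix.mul_assoc B] at h2
  have h3 := idf_cancel B hB _ _ h2
  have g := idf_gain A B P hr _ rfl
  have g' := idf_gain A B P' hr' _ h3
  have u := idf_unit A hA B _ _ g
  exact idf_rcancel _ u _ _ (g.symm.trans g')

lemma idf_tele {W : Type*} [AddCommGroup W] (L : W →+ W) (f : ℕ → W) (N : ℕ)
    (hf : ∀ k, k + 1 < N → f (k + 1) = L (f k) + f 0) (k : ℕ) (hk : k + 1 < N) :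
    f (k + 1) - f k = L^[k + 1] (f 0) := by
  induction k with
  | zero => rw [hf 0 hk]; simp
  | succ k ih =>
    rw [hf (k + 1) hk, Function.iterate_succ_apply', ← ih (by omega), map_sub]
    nth_rewrite 2 [hf k (by omega)]
    abel

lemma idf_tele_zero {W V : Type*} [AddCommGroup W] [AddCommGroup V] (L : W →+ W) (F : W →+ V)
    (f : ℕ → W) (N : ℕ)
    (hf : ∀ k, k + 1 < N → f (k + 1) = L (f k) + f 0)
    (hF : ∀ k, k + 1 < N → F (f k) = 0) (k : ℕ) (hk : k + 1 < N) : F (L^[k] (f 0)) = 0 := by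
  cases k with
  | zero => exact hF 0 hk
  | succ k =>
    rw [← idf_tele L f N hf k (by omega), map_sub, hF _ hk, hF _ (by omega), sub_zero]

lemma idf_symm {n m : ℕ} (A : Matrix (Fin n) (Fin n) ℝ) (B : Matrix (Fin n) (Fin m) ℝ)
    (ν : ℕ) (Q : Matrix (Fin n) (Fin n) ℝ) (hQ : Q.IsSymm)
    (P : ℕ → Matrix (Fin n) (Fin n) ℝ) (hPν : P ν = Q)
    (hPrec : ∀ t : ℕ, 1 ≤ t → t < ν →
      P t = Aᵀ * P (t + 1) * A + Q -
        (Bᵀ * P (t + 1) * A)ᵀ * (Bᵀ * P (t + 1) * B + 1)⁻¹ * (Bᵀ * P (t + 1) * A))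
    (k : ℕ) (hk : k < ν) : (P (ν - k)).IsSymm := by
  induction k with
  | zero => simpa [hPν] using hQ
  | succ k ih =>
    have ih := ih (by omega)
    have e : ν - (k + 1) + 1 = ν - k := by omega
    rw [hPrec _ (by omega) (by omega), e]
    unfold Matrix.IsSymm at *
    simp only [Matrix.transpose_sub, Matrix.transpose_add, Matrix.transpose_mul,
      Matrix.transpose_transpose, Matrix.transpose_nonsing_inv, Matrix.transpose_one, ih, hQ,
      Matrix.mul_assoc]

theorem identifiability {n m : ℕ}
    (A : Matrix (Fin n) (Fin n) ℝ) (B : Matrix (Fin n) (Fin m) ℝ)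
    (hA : IsUnit A) (hB : B.rank = m) (hctrb : (ctrbMatrix A B).rank = n)
    (ν : ℕ) (hν : n + 1 ≤ ν) (d : Fin n → ℝ)
    (Q Q' : Matrix (Fin n) (Fin n) ℝ) (hQ : Q.IsSymm) (hQ' : Q'.IsSymm)
    (q q' : Fin n → ℝ)
    (P P' : ℕ → Matrix (Fin n) (Fin n) ℝ) (η η' : ℕ → Fin n → ℝ)
    (hPν : P ν = Q) (hην : η ν = q) (hPν' : P' ν = Q') (hην' : η' ν = q')
    (hPrec : ∀ t : ℕ, 1 ≤ t → t < ν →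
      P t = Aᵀ * P (t + 1) * A + Q -
        (Bᵀ * P (t + 1) * A)ᵀ * (Bᵀ * P (t + 1) * B + 1)⁻¹ * (Bᵀ * P (t + 1) * A))
    (hηrec : ∀ t : ℕ, 1 ≤ t → t < ν →
      η t = (A - B * (Bᵀ * P (t + 1) * B + 1)⁻¹ * (Bᵀ * P (t + 1) * A))ᵀ.mulVec
          (η (t + 1) + (P (t + 1)).mulVec d) + q)
    (hPrec' : ∀ t : ℕ, 1 ≤ t → t < ν →
      P' t = Aᵀ * P' (t + 1) * A + Q' -
        (Bᵀ * P' (t + 1) * A)ᵀ * (Bᵀ * P' (t + 1) * B + 1)⁻¹ * (Bᵀ * P' (t + 1) * A))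
    (hηrec' : ∀ t : ℕ, 1 ≤ t → t < ν →
      η' t = (A - B * (Bᵀ * P' (t + 1) * B + 1)⁻¹ * (Bᵀ * P' (t + 1) * A))ᵀ.mulVec
          (η' (t + 1) + (P' (t + 1)).mulVec d) + q')
    (hPD : ∀ t : ℕ, 1 ≤ t → t < ν → (Bᵀ * P (t + 1) * B + 1).PosDef)
    (hPD' : ∀ t : ℕ, 1 ≤ t → t < ν → (Bᵀ * P' (t + 1) * B + 1).PosDef)
    (hcl : ∀ t : ℕ, 1 ≤ t → t < ν →
      extClosedLoop A B d (P (t + 1)) (η (t + 1)) =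
        extClosedLoop A B d (P' (t + 1)) (η' (t + 1))) :
    Q = Q' ∧ q = q' := by
  classical
  have hBi : Function.Injective B.mulVec := idf_inj B (by rw [hB, Fintype.card_fin])
  have hr := fun t h1 h2 => (hPD t h1 h2).isUnit
  have hr' := fun t h1 h2 => (hPD' t h1 h2).isUnit
  have hS := idf_symm A B ν Q hQ P hPν hPrec
  have hS' := idf_symm A B ν Q' hQ' P' hPν' hPrec'
  have hBP : ∀ t, 1 ≤ t → t < ν → Bᵀ * P (t + 1) = Bᵀ * P' (t + 1) := by
    intro t h1 h2
    refine idf_step A B hA hBi _ _ (hr t h1 h2) (hr' t h1 h2) ?_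
    ext i j
    exact congrFun (congrFun (hcl t h1 h2) (Sum.inl i)) (Sum.inl j)
  have hBPk : ∀ k, k + 1 < ν → Bᵀ * (P (ν - k) - P' (ν - k)) = 0 := by
    intro k hk
    have e : ν - (k + 1) + 1 = ν - k := by omega
    have := hBP (ν - (k + 1)) (by omega) (by omega)
    rw [e] at this
    rw [Matrix.mul_sub, this, sub_self]
  have hrecD : ∀ k, k + 1 < ν → P (ν - (k + 1)) - P' (ν - (k + 1)) =
      Aᵀ * (P (ν - k) - P' (ν - k)) * A + (P (ν - 0) - P' (ν - 0)) := by
    intro k hk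
    have e : ν - (k + 1) + 1 = ν - k := by omega
    have h := hBP (ν - (k + 1)) (by omega) (by omega)
    have h1 := hPrec (ν - (k + 1)) (by omega) (by omega)
    have h2 := hPrec' (ν - (k + 1)) (by omega) (by omega)
    rw [e] at h h1 h2
    rw [← h] at h2
    rw [h1, h2, Nat.sub_zero, hPν, hPν', Matrix.mul_sub, Matrix.sub_mul]
    abel
  have hQQ : Q = Q' := by
    let L : Matrix (Fin n) (Fin n) ℝ →+ Matrix (Fin n) (Fin n) ℝ :=
      ⟨⟨fun X => Aᵀ * X * A, by simp⟩, by intro X Y; simp [Matrix.mul_add, Matrix.add_mul]⟩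
    let F : Matrix (Fin n) (Fin n) ℝ →+ Matrix (Fin m) (Fin n) ℝ :=
      ⟨⟨fun X => Bᵀ * X, by simp⟩, by intro X Y; simp [Matrix.mul_add]⟩
    have hz := idf_tele_zero L F (fun k => P (ν - k) - P' (ν - k)) ν hrecD hBPk
    simp only [Nat.sub_zero, hPν, hPν'] at hz
    have hL : ∀ k X, L^[k] X = Aᵀ ^ k * X * A ^ k := by
      intro k X
      induction k with
      | zero => simp
      | succ k ih =>
        rw [Function.iterate_succ_apply', ih]
        change Aᵀ * (Aᵀ ^ k * X * A ^ k) * A = _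
        rw [pow_succ', pow_succ]
        simp only [Matrix.mul_assoc]
    have hz2 : ∀ k < n, Bᵀ * (Aᵀ ^ k * (Q - Q')) = 0 := by
      intro k hk
      have h := hz k (by omega)
      rw [hL] at h
      change Bᵀ * (Aᵀ ^ k * (Q - Q') * A ^ k) = 0 at h
      refine idf_rcancel _ (hA.pow k) _ _ ?_
      rw [Matrix.zero_mul, Matrix.mul_assoc]
      exact h
    have hcol : ∀ j, (Q - Q')ᵀ j = 0 := by
      intro j
      refine idf_ctrb A B hctrb _ fun k hk => ?_
      ext i
      have h := congrFun (congrFun (hz2 k hk) i) j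
      exact h
    rw [← sub_eq_zero]
    ext i j
    exact congrFun (hcol j) i
  refine ⟨hQQ, ?_⟩
  have hPP : ∀ k, k < ν → P (ν - k) = P' (ν - k) := by
    intro k
    induction k with
    | zero => intro _; rw [Nat.sub_zero, hPν, hPν', hQQ]
    | succ k ih =>
      intro hk
      have := hrecD k hk
      rw [ih (by omega), Nat.sub_zero, hPν, hPν', hQQ] at this
      simpa [sub_eq_zero] using this
  have hBη : ∀ k, k + 1 < ν → Bᵀ.mulVec (η (ν - k) - η' (ν - k)) = 0 := by
    intro k hk
    have e : ν - (k + 1) + 1 = ν - k := by omega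
    have h := hcl (ν - (k + 1)) (by omega) (by omega)
    have hu := hr (ν - (k + 1)) (by omega) (by omega)
    rw [e] at h hu
    rw [← hPP k (by omega)] at h
    have h2 : d - (B * (Bᵀ * P (ν - k) * B + 1)⁻¹).mulVec
          (Bᵀ.mulVec (η (ν - k)) + (Bᵀ * P (ν - k)).mulVec d) =
        d - (B * (Bᵀ * P (ν - k) * B + 1)⁻¹).mulVec
          (Bᵀ.mulVec (η' (ν - k)) + (Bᵀ * P (ν - k)).mulVec d) := by
      ext i
      exact congrFun (congrFun h (Sum.inl i)) (Sum.inr ())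
    have h3 := sub_right_injective h2
    simp only [← Matrix.mulVec_mulVec _ B] at h3
    have h4 := Matrix.mulVec_injective_iff_isUnit.2
      ((Matrix.isUnit_nonsing_inv_iff).2 hu) (hBi h3)
    rw [Matrix.mulVec_sub, sub_eq_zero]
    exact add_right_cancel h4
  have hrecE : ∀ k, k + 1 < ν → η (ν - (k + 1)) - η' (ν - (k + 1)) =
      Aᵀ.mulVec (η (ν - k) - η' (ν - k)) + (η (ν - 0) - η' (ν - 0)) := by
    intro k hk
    have e : ν - (k + 1) + 1 = ν - k := by omega
    have h1 := hηrec (ν - (k + 1)) (by omega) (by omega)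
    have h2 := hηrec' (ν - (k + 1)) (by omega) (by omega)
    rw [e] at h1 h2
    rw [← hPP k (by omega)] at h2
    rw [h1, h2, Nat.sub_zero, hην, hην', add_sub_add_comm, ← Matrix.mulVec_sub,
      add_sub_add_right_eq_sub, Matrix.mul_assoc B, Matrix.transpose_sub, Matrix.transpose_mul B,
      Matrix.sub_mulVec, ← Matrix.mulVec_mulVec, hBη k hk, Matrix.mulVec_zero, sub_zero]
  let L : (Fin n → ℝ) →+ (Fin n → ℝ) :=
    ⟨⟨fun X => Aᵀ.mulVec X, by simp⟩, by intro X Y; simp [Matrix.mulVec_add]⟩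
  let F : (Fin n → ℝ) →+ (Fin m → ℝ) :=
    ⟨⟨fun X => Bᵀ.mulVec X, by simp⟩, by intro X Y; simp [Matrix.mulVec_add]⟩
  have hz := idf_tele_zero L F (fun k => η (ν - k) - η' (ν - k)) ν hrecE hBη
  simp only [Nat.sub_zero, hην, hην'] at hz
  have hL : ∀ k X, L^[k] X = (Aᵀ ^ k).mulVec X := by
    intro k X
    induction k with
    | zero => simp
    | succ k ih =>
      rw [Function.iterate_succ_apply', ih, pow_succ', ← Matrix.mulVec_mulVec]
      rfl
  rw [← sub_eq_zero]
  refine idf_ctrb A B hctrb _ fun k hk => ?_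
  have h := hz k (by omega)
  rw [hL] at h
  exact h
end

section
/- Let A (n×n), B (n×m) be real matrices, Q a real symmetric n×n matrix, R a real symmetric m×m matrix, q, d ∈ ℝ^n, and ν ≥ 2 an integer. Let P_1,…,P_ν be real symmetric n×n matrices with P_ν = Q and η_1,…,η_ν ∈ ℝ^n with η_ν = q. For t = 1,…,ν−1 define 𝔯_t := BᵀP_{t+1}B + R, 𝔰_t := BᵀP_{t+1}A, g_t := Bᵀη_{t+1} + BᵀP_{t+1}d, β_t := q + AᵀP_{t+1}d + Aᵀη_{t+1} − η_t, and let 𝔯⁺_t be a Moore–Penrose pseudoinverse of 𝔯_t. Then the following are equivalent: (i) for all t = 1,…,ν−1: P_t = AᵀP_{t+1}A + Q − 𝔰_tᵀ𝔯⁺_t𝔰_t, η_t = (A − B𝔯⁺_t𝔰_t)ᵀ(η_{t+1} + P_{t+1}d) + q, 𝔯_t is positive semidefinite, and every v with 𝔯_t v = 0 satisfies 𝔰_tᵀ v = 0 and g_tᵀ v = 0; (ii) there exist real numbers ξ_1,…,ξ_{ν−1} such that for all t = 1,…,ν−1 the matrix H_t = [[𝔯_t, 𝔰_t, g_t], [𝔰_tᵀ,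 AᵀP_{t+1}A + Q − P_t, β_t], [g_tᵀ, β_tᵀ, ξ_t]] is positive semidefinite and rank(H_t) = rank(𝔯_t). -/
open Matrix

lemma IsMoorePenrose.symm_of_symm {m : ℕ} {R Rp : Matrix (Fin m) (Fin m) ℝ} (hR : R.IsSymm)
    (h : IsMoorePenrose R Rp) : Rpᵀ = Rp := by
  obtain ⟨h1, h2, h3, h4⟩ := h
  have hR' : Rᵀ = R := hR
  rw [transpose_mul, hR'] at h3 h4
  have h2' : Rpᵀ * R * Rpᵀ = Rpᵀ := by
    have := congrArg transpose h2
    simpa [transpose_mul, hR', Matrix.mul_assoc] using this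
  have hEF : Rp * R = R * Rp := by
    calc Rp * R = Rp * (R * Rp * R) := by rw [h1]
      _ = (Rp * R) * (Rp * R) := by simp only [Matrix.mul_assoc]
      _ = (Rp * R) * (R * Rpᵀ) := by rw [h4]
      _ = Rp * (R * (R * Rpᵀ)) := by simp only [Matrix.mul_assoc]
      _ = Rp * (R * (Rp * R)) := by rw [h4]
      _ = Rp * (R * Rp * R) := by simp only [Matrix.mul_assoc]
      _ = Rp * R := by rw [h1]
      _ = R * Rpᵀ := h4.symm
      _ = R * Rp := by
        calc R * Rpᵀ = (R * Rp * R) * Rpᵀ := by rw [h1]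
          _ = (R * Rp) * (R * Rpᵀ) := by simp only [Matrix.mul_assoc]
          _ = (Rpᵀ * R) * (Rp * R) := by rw [h3, h4]
          _ = Rpᵀ * (R * Rp * R) := by simp only [Matrix.mul_assoc]
          _ = R * Rp := by rw [h1, h3]
  calc Rpᵀ = Rpᵀ * R * Rpᵀ := h2'.symm
    _ = R * Rp * Rpᵀ := by rw [h3]
    _ = Rp * (R * Rpᵀ) := by rw [← hEF, Matrix.mul_assoc]
    _ = Rp * (R * Rp) := by rw [h4, hEF]
    _ = Rp := by rw [← Matrix.mul_assoc, h2]

lemma block_core {m : ℕ} {k : Type} [Fintype k] [DecidableEq k]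
    {R Rp : Matrix (Fin m) (Fin m) ℝ} (hR : R.IsSymm)
    (h : IsMoorePenrose R Rp) (U : Matrix (Fin m) k ℝ) (D : Matrix k k ℝ) :
    ((fromBlocks R U Uᵀ D).PosSemidef ∧ (fromBlocks R U Uᵀ D).rank = R.rank) ↔
    (R.PosSemidef ∧ (∀ v : Fin m → ℝ, R *ᵥ v = 0 → Uᵀ *ᵥ v = 0) ∧ D = Uᵀ * Rp * U) := by
  have hR' : Rᵀ = R := hR
  have hRp := h.symm_of_symm hR
  obtain ⟨h1, h2, h3, h4⟩ := h
  constructor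
  · rintro ⟨hpsd, hrank⟩
    have hRpsd : R.PosSemidef := by
      have := hpsd.submatrix (Sum.inl : Fin m → Fin m ⊕ k)
      exact this
    set H := fromBlocks R U Uᵀ D with hH
    let E1 : Matrix (Fin m ⊕ k) (Fin m) ℝ := fromRows 1 0
    have hHE : H * E1 = fromRows R Uᵀ := by
      ext i j
      rcases i with i | i <;> simp [hH, E1, fromBlocks_mul_fromRows]
    have hle : LinearMap.range (H * E1).mulVecLin ≤ LinearMap.range H.mulVecLin := by
      rw [Matrix.mulVecLin_mul]
      exact LinearMap.range_comp_le_range _ _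
    have hge : R.rank ≤ (H * E1).rank := by
      have : R = (fromCols (1 : Matrix (Fin m) (Fin m) ℝ) (0 : Matrix (Fin m) k ℝ)) * (H * E1) := by
        rw [hHE, fromCols_mul_fromRows]; simp
      conv_lhs => rw [this]
      exact rank_mul_le_right _ _
    have heq : LinearMap.range (H * E1).mulVecLin = LinearMap.range H.mulVecLin := by
      apply Submodule.eq_of_le_of_finrank_le hle
      change H.rank ≤ (H * E1).rank
      omega
    have hx : ∀ j : k, ∃ x : Fin m → ℝ, (fromRows R Uᵀ) *ᵥ x = H *ᵥ (Pi.single (Sum.inr j) 1) := by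
      intro j
      have : H *ᵥ (Pi.single (Sum.inr j) 1) ∈ LinearMap.range H.mulVecLin := ⟨_, rfl⟩
      rw [← heq, hHE] at this
      obtain ⟨x, hx⟩ := this
      exact ⟨x, hx⟩
    choose x hx using hx
    let X : Matrix (Fin m) k ℝ := Matrix.of fun i j => x j i
    have hU : U = R * X := by
      ext i j
      have := congrFun (hx j) (Sum.inl i)
      simp [hH] at this
      rw [Matrix.mul_apply]
      exact this.symm
    have hD : D = Uᵀ * X := by
      ext i j
      have := congrFun (hx j) (Sum.inr i)
      simp [hH] at this
      rw [Matrix.mul_apply]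
      exact this.symm
    refine ⟨hRpsd, ?_, ?_⟩
    · intro v hv
      rw [hU, transpose_mul, hR', ← mulVec_mulVec, hv, mulVec_zero]
    · have : Uᵀ * Rp * U = Uᵀ * X := by
        rw [hU, transpose_mul, hR']
        calc Xᵀ * R * Rp * (R * X) = Xᵀ * (R * Rp * R) * X := by simp only [Matrix.mul_assoc]
          _ = _ := by rw [h1]
      rw [this, ← hD]
  · rintro ⟨hpsd, hker, hD⟩
    have hU1 : Uᵀ * Rp * R = Uᵀ := by
      have h0 : R * (1 - Rp * R) = 0 := by
        rw [Matrix.mul_sub, ← Matrix.mul_assoc, h1]; simp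
      have : Uᵀ * (1 - Rp * R) = 0 := by
        ext i j
        have hv := hker ((1 - Rp * R).col j) (by
          ext i'
          exact congrFun (congrFun h0 i') j)
        exact congrFun hv i
      rw [Matrix.mul_sub, Matrix.mul_one, sub_eq_zero, ← Matrix.mul_assoc] at this
      exact this.symm
    have hU2 : R * (Rp * U) = U := by
      have := congrArg transpose hU1
      simpa [transpose_mul, hR', hRp] using this
    let K : Matrix (Fin m) (Fin m ⊕ k) ℝ := fromCols 1 (Rp * U)
    have hK : fromBlocks R U Uᵀ D = Kᴴ * R * K := by
      have hKt : Kᴴ = fromRows 1 (Uᵀ * Rp) := by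
        simp only [K, conjTranspose_eq_transpose_of_trivial, transpose_fromCols, transpose_mul, hRp,
          transpose_one]
      rw [hKt, fromRows_mul, Matrix.one_mul, hU1, fromRows_mul_fromCols]
      rw [hU2, hD]; simp [Matrix.mul_assoc]
    constructor
    · rw [hK]
      exact hpsd.conjTranspose_mul_mul_same K
    · apply le_antisymm
      · rw [hK]
        exact (rank_mul_le_left _ _).trans (rank_mul_le_right _ _)
      · have : R = (fromCols (1 : Matrix (Fin m) (Fin m) ℝ) (0 : Matrix (Fin m) k ℝ)) *
            (fromBlocks R U Uᵀ D * fromRows (1 : Matrix (Fin m) (Fin m) ℝ) (0 : Matrix k (Fin m) ℝ)) := by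
          rw [fromBlocks_mul_fromRows, fromCols_mul_fromRows]; simp
        conv_lhs => rw [this]
        exact (rank_mul_le_right _ _).trans (rank_mul_le_left _ _)

lemma blockH_core {m n : ℕ} {R Rp : Matrix (Fin m) (Fin m) ℝ} (hR : R.IsSymm)
    (h : IsMoorePenrose R Rp) (S : Matrix (Fin m) (Fin n) ℝ)
    (g : Fin m → ℝ) (C : Matrix (Fin n) (Fin n) ℝ) (β : Fin n → ℝ) (ξ : ℝ) :
    ((blockH R S g C β ξ).PosSemidef ∧ (blockH R S g C β ξ).rank = R.rank) ↔
    (R.PosSemidef ∧ (∀ v : Fin m → ℝ, R *ᵥ v = 0 → Sᵀ *ᵥ v = 0 ∧ g ⬝ᵥ v = 0) ∧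
      C = Sᵀ * Rp * S ∧ β = Sᵀ *ᵥ (Rp *ᵥ g) ∧ ξ = g ⬝ᵥ (Rp *ᵥ g)) := by
  have hRp := h.symm_of_symm hR
  have hH : blockH R S g C β ξ = fromBlocks R (fromCols S (replicateCol Unit g))
      (fromCols S (replicateCol Unit g))ᵀ
      (fromBlocks C (replicateCol Unit β) (replicateRow Unit β) (Matrix.of fun _ _ => ξ)) := by
    ext i j
    rcases i with i | i | i <;> rcases j with j | j | j <;> rfl
  rw [hH, block_core hR h]
  have e1 : ∀ v : Fin m → ℝ, (fromCols S (replicateCol Unit g))ᵀ *ᵥ v = 0 ↔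
      (Sᵀ *ᵥ v = 0 ∧ g ⬝ᵥ v = 0) := by
    intro v
    constructor
    · intro hv
      exact ⟨funext fun i => congrFun hv (Sum.inl i), congrFun hv (Sum.inr ())⟩
    · rintro ⟨ha, hb⟩
      funext i
      rcases i with i | i
      · exact congrFun ha i
      · exact hb
  have e2 : (fromCols S (replicateCol Unit g))ᵀ * Rp * fromCols S (replicateCol Unit g) =
      fromBlocks (Sᵀ * Rp * S) (replicateCol Unit (Sᵀ *ᵥ (Rp *ᵥ g)))
        (replicateRow Unit (Sᵀ *ᵥ (Rp *ᵥ g))) (Matrix.of fun _ _ => g ⬝ᵥ (Rp *ᵥ g)) := by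
    rw [transpose_fromCols, fromRows_mul, fromRows_mul_fromCols]
    congr 1
    · rw [mulVec_mulVec, replicateCol_mulVec]
    · have : (replicateCol Unit g)ᵀ * Rp * S = (Sᵀ * Rp * replicateCol Unit g)ᵀ := by
        simp [transpose_mul, hRp, Matrix.mul_assoc]
      rw [this, mulVec_mulVec, ← replicateCol_mulVec]; rfl
    · rw [Matrix.mul_assoc, ← replicateCol_mulVec]; rfl
  rw [e2]
  simp only [e1]
  refine and_congr_right fun _ => and_congr_right fun _ => ?_
  rw [fromBlocks_inj]
  constructor
  · rintro ⟨a, b, _, c⟩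
    exact ⟨a, funext fun i => congrFun (congrFun b i) (), congrFun (congrFun c ()) ()⟩
  · rintro ⟨a, b, c⟩
    subst b c
    exact ⟨a, rfl, rfl, rfl⟩

theorem riccati_iff_sdp_rank {n m ν : ℕ} (hν : 2 ≤ ν)
    (A : Matrix (Fin n) (Fin n) ℝ) (B : Matrix (Fin n) (Fin m) ℝ)
    (Q : Matrix (Fin n) (Fin n) ℝ) (R : Matrix (Fin m) (Fin m) ℝ)
    (hQ : Q.IsSymm) (hR : R.IsSymm) (q d : Fin n → ℝ)
    (P : ℕ → Matrix (Fin n) (Fin n) ℝ) (η : ℕ → Fin n → ℝ)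
    (hPsymm : ∀ t : ℕ, 1 ≤ t → t ≤ ν → (P t).IsSymm)
    (hPν : P ν = Q) (hην : η ν = q)
    (𝔯p : ℕ → Matrix (Fin m) (Fin m) ℝ)
    (h𝔯p : ∀ t : ℕ, 1 ≤ t → t < ν → IsMoorePenrose (Bᵀ * P (t + 1) * B + R) (𝔯p t)) :
    (∀ t : ℕ, 1 ≤ t → t < ν →
      P t = Aᵀ * P (t + 1) * A + Q -
          (Bᵀ * P (t + 1) * A)ᵀ * 𝔯p t * (Bᵀ * P (t + 1) * A) ∧
      η t = (A - B * 𝔯p t * (Bᵀ * P (t + 1) * A))ᵀ.mulVec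
          (η (t + 1) + (P (t + 1)).mulVec d) + q ∧
      (Bᵀ * P (t + 1) * B + R).PosSemidef ∧
      (∀ v : Fin m → ℝ, (Bᵀ * P (t + 1) * B + R).mulVec v = 0 →
        (Bᵀ * P (t + 1) * A)ᵀ.mulVec v = 0 ∧
        (Bᵀ.mulVec (η (t + 1)) + (Bᵀ * P (t + 1)).mulVec d) ⬝ᵥ v = 0)) ↔
    (∃ ξ : ℕ → ℝ, ∀ t : ℕ, 1 ≤ t → t < ν →
      (blockH (Bᵀ * P (t + 1) * B + R) (Bᵀ * P (t + 1) * A)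
          (Bᵀ.mulVec (η (t + 1)) + (Bᵀ * P (t + 1)).mulVec d)
          (Aᵀ * P (t + 1) * A + Q - P t)
          (q + (Aᵀ * P (t + 1)).mulVec d + Aᵀ.mulVec (η (t + 1)) - η t)
          (ξ t)).PosSemidef ∧
      (blockH (Bᵀ * P (t + 1) * B + R) (Bᵀ * P (t + 1) * A)
          (Bᵀ.mulVec (η (t + 1)) + (Bᵀ * P (t + 1)).mulVec d)
          (Aᵀ * P (t + 1) * A + Q - P t)
          (q + (Aᵀ * P (t + 1)).mulVec d + Aᵀ.mulVec (η (t + 1)) - η t)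
          (ξ t)).rank = (Bᵀ * P (t + 1) * B + R).rank) := by
  have key : ∀ t : ℕ, 1 ≤ t → t < ν → ∀ ξ : ℝ, _ := fun t h1 h2 ξ =>
    blockH_core (R := Bᵀ * P (t + 1) * B + R) (Rp := 𝔯p t) (by
      have hP : (P (t + 1))ᵀ = P (t + 1) := hPsymm (t + 1) (by omega) (by omega)
      have hR' : Rᵀ = R := hR
      change (Bᵀ * P (t + 1) * B + R)ᵀ = _
      simp [transpose_mul, hP, hR', Matrix.mul_assoc]) (h𝔯p t h1 h2)
      (Bᵀ * P (t + 1) * A)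
      (Bᵀ.mulVec (η (t + 1)) + (Bᵀ * P (t + 1)).mulVec d)
      (Aᵀ * P (t + 1) * A + Q - P t)
      (q + (Aᵀ * P (t + 1)).mulVec d + Aᵀ.mulVec (η (t + 1)) - η t) ξ
  have hη : ∀ t : ℕ, 1 ≤ t → t < ν →
      (A - B * 𝔯p t * (Bᵀ * P (t + 1) * A))ᵀ.mulVec (η (t + 1) + (P (t + 1)).mulVec d) + q =
      q + (Aᵀ * P (t + 1)).mulVec d + Aᵀ.mulVec (η (t + 1)) -
        (Bᵀ * P (t + 1) * A)ᵀ *ᵥ (𝔯p t *ᵥ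
          (Bᵀ.mulVec (η (t + 1)) + (Bᵀ * P (t + 1)).mulVec d)) := by
    intro t h1 h2
    have hP : (P (t + 1))ᵀ = P (t + 1) := hPsymm (t + 1) (by omega) (by omega)
    have hRp : (𝔯p t)ᵀ = 𝔯p t := by
      refine (h𝔯p t h1 h2).symm_of_symm ?_
      have hR' : Rᵀ = R := hR
      change (Bᵀ * P (t + 1) * B + R)ᵀ = _
      simp [transpose_mul, hP, hR', Matrix.mul_assoc]
    have hw : Bᵀ.mulVec (η (t + 1)) + (Bᵀ * P (t + 1)).mulVec d =
        Bᵀ *ᵥ (η (t + 1) + (P (t + 1)).mulVec d) := by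
      rw [mulVec_add, mulVec_mulVec]
    have hw2 : q + (Aᵀ * P (t + 1)).mulVec d + Aᵀ.mulVec (η (t + 1)) =
        Aᵀ *ᵥ (η (t + 1) + (P (t + 1)).mulVec d) + q := by
      rw [mulVec_add, mulVec_mulVec]; abel
    rw [hw, hw2, transpose_sub, sub_mulVec, transpose_mul (B * 𝔯p t), transpose_mul B, hRp,
      mulVec_mulVec, mulVec_mulVec]
    simp only [Matrix.mul_assoc]
    abel
  constructor
  · intro h
    refine ⟨fun t => (Bᵀ.mulVec (η (t + 1)) + (Bᵀ * P (t + 1)).mulVec d) ⬝ᵥ (𝔯p t *ᵥ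
          (Bᵀ.mulVec (η (t + 1)) + (Bᵀ * P (t + 1)).mulVec d)), fun t h1 h2 => ?_⟩
    obtain ⟨a, b, c, e⟩ := h t h1 h2
    rw [hη t h1 h2] at b
    refine (key t h1 h2 _).2 ⟨c, e, ?_, ?_, rfl⟩
    · nth_rewrite 1 [a]; abel
    · nth_rewrite 1 [b]; abel
  · rintro ⟨ξ, h⟩ t h1 h2
    obtain ⟨c, e, a, b, -⟩ := (key t h1 h2 _).1 (h t h1 h2)
    refine ⟨?_, ?_, c, e⟩
    · rw [← a]; abel
    · rw [hη t h1 h2, ← b]; abel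
end
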